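/- Let k be a field of prime characteristic p and let P be a nontrivial finite p-group. Let V = ⨁_{Q ≤ P} kP⊗_{kQ}k, the direct sum over all subgroups Q of P of the kP-modules induced from the trivial kQ-module, and set F = End_{kP}(V). Then the dominant dimension of F is exactly 2: there exists an exact sequence 0 → F → J⁰ → J¹ of right F-modules with J⁰ and J¹ both projective and injective, but there is no injective resolution 0 → F → J⁰ → J¹ → J² → ⋯ of F as a right F-module with J⁰, J¹ and J² all projective. -/

import Mathlib

open CategoryTheory

/-- The `kP`-module `V = ⨁_{Q ≤ P} kP ⊗_{kQ} k`: the direct sum, over all subgroups `Q` of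
`P`, of the `kP`-modules induced from the trivial `kQ`-module `k`.  The module induced from
the trivial `kQ`-module is (canonically isomorphic to) the permutation module `k[P/Q]` on the
cosets `P ⧸ Q`; since `P` is finite there are finitely many subgroups, so the product below
is the direct sum. -/
noncomputable abbrev SumOfInducedTrivialModulesCat (k : Type) [Field k] (P : Type) [Group P] :
    ModuleCat (MonoidAlgebra k P) :=
  ModuleCat.of (MonoidAlgebra k P)
    (Π Q : Subgroup P, (Representation.ofMulAction k P (P ⧸ Q)).asModule)

/-- The endomorphism algebra `F = End_{kP}(V)` of `V = ⨁_{Q ≤ P} kP ⊗_{kQ} k`. -/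
noncomputable abbrev EndOfSumOfInducedTrivialModules (k : Type) [Field k] (P : Type)
    [Group P] : Type :=
  End (SumOfInducedTrivialModulesCat k P)

/-- `R` admits an injective resolution `0 → R → I⁰ → I¹ → ⋯` of `R` as a right `R`-module
(i.e. as a module over `Rᵐᵒᵖ`) whose first `d` terms `I⁰, …, I^{d-1}` are projective. -/
def HasInjectiveResolutionWithProjectivePrefix (R : Type) [Ring R] (d : ℕ) : Prop :=
  ∃ (I : ℕ → ModuleCat.{0} Rᵐᵒᵖ) (f₀ : R →ₗ[Rᵐᵒᵖ] I 0)
    (f : ∀ n : ℕ, (I n : Type) →ₗ[Rᵐᵒᵖ] I (n + 1)),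
      Function.Injective f₀ ∧ Function.Exact f₀ (f 0) ∧
      (∀ n : ℕ, Function.Exact (f n) (f (n + 1))) ∧
      (∀ n : ℕ, Module.Injective Rᵐᵒᵖ (I n)) ∧
      (∀ n : ℕ, n < d → Module.Projective Rᵐᵒᵖ (I n))


namespace DomDimAux

section Chi
theorem exists_functional' {p : ℕ} [Fact p.Prime] {C : Type} [AddCommGroup C]
    [Module (ZMod p) C] {c : C} (hc : c ≠ 0) : ∃ f : C →+ ZMod p, f c ≠ 0 := by
  obtain ⟨f, hf⟩ := Module.Projective.exists_dual_ne_zero (ZMod p) hc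
  exact ⟨f.toAddMonoidHom, hf⟩

theorem exists_functional {p : ℕ} (hp : p.Prime) {C : Type} [AddCommGroup C]
    (hC : ∀ c : C, p • c = 0) {c : C} (hc : c ≠ 0) : ∃ f : C →+ ZMod p, f c ≠ 0 := by
  have : Fact p.Prime := ⟨hp⟩
  exact @exists_functional' p this C _ (AddCommGroup.zmodModule hC) c hc

theorem exists_chi (k : Type) [Field k] (p : ℕ) (hp : p.Prime) [CharP k p]
    (P : Type) [Group P] [Finite P] [Nontrivial P] (hP : IsPGroup p P) :
    ∃ χ : P → k, (∀ g h, χ (g * h) = χ g + χ h) ∧ ∃ h, χ h ≠ 0 := by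
  have : Fact p.Prime := ⟨hp⟩
  have := hP.isNilpotent
  have hlt : commutator P < ⊤ := Group.IsSolvable.commutator_lt_top_of_nontrivial P
  obtain ⟨x, -, hx⟩ := SetLike.exists_of_lt hlt
  let B := Additive (Abelianization P)
  let ab : P → B := fun x => Additive.ofMul (Abelianization.of x)
  have hx0 : ab x ≠ 0 := by
    intro h
    apply hx
    have : Abelianization.of x = 1 := h
    exact (QuotientGroup.eq_one_iff x).1 this
  have : Finite B := inferInstanceAs (Finite (P ⧸ commutator P))
  have hsurj : ∀ b : B, ∃ x, ab x = b := fun b => QuotientGroup.mk_surjective b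
  -- multiplication by p
  let m : B →+ B := nsmulAddMonoidHom p
  have hninj : ¬ Function.Injective m := by
    intro hinj
    obtain ⟨n, hn⟩ := hP x
    have h2 : (p ^ n) • ab x = 0 := by
      change Additive.ofMul ((Abelianization.of x) ^ (p ^ n)) = 0
      rw [← map_pow, hn, map_one]; rfl
    have h3 : ∀ n : ℕ, ∀ b : B, (p ^ n) • b = 0 → b = 0 := by
      intro n
      induction n with
      | zero => intro b hb; simpa using hb
      | succ n ih =>
        intro b hb
        apply ih
        apply hinj
        rw [map_zero]
        change p • (p ^ n • b) = 0
        rw [← mul_smul, ← pow_succ']; exact hb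
    exact hx0 (h3 n _ h2)
  have hnsurj : ¬ Function.Surjective m := fun h => hninj (Finite.injective_iff_surjective.2 h)
  have : ∃ b, b ∉ m.range := by
    by_contra! h
    exact hnsurj fun b => h b
  obtain ⟨b, hb⟩ := this
  let C := B ⧸ m.range
  have hC : ∀ c : C, p • c = 0 := by
    intro c
    obtain ⟨c, rfl⟩ := QuotientAddGroup.mk_surjective c
    rw [← QuotientAddGroup.mk_nsmul]
    exact (QuotientAddGroup.eq_zero_iff _).2 ⟨c, rfl⟩
  have hb0 : (QuotientAddGroup.mk b : C) ≠ 0 := fun h => hb ((QuotientAddGroup.eq_zero_iff _).1 h)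
  obtain ⟨f, hf⟩ := exists_functional hp hC hb0
  refine ⟨fun y => ZMod.castHom (dvd_refl p) k (f (QuotientAddGroup.mk (ab y) : C)), ?_, ?_⟩
  · intro g h
    rw [← map_add, ← map_add]
    congr 2
  · obtain ⟨y, rfl⟩ := hsurj b
    refine ⟨y, fun h => hf ?_⟩
    exact (ZMod.castHom (dvd_refl p) k).injective (by rw [map_zero]; exact h)
end Chi

section Lemma
/-- The ring-theoretic core of the upper bound. -/
theorem core {F : Type} [Ring F] (e q ε : F) (G : F → F)
    (hGadd : ∀ x y, ε * x = 0 → ε * y = 0 → G (x + y) = G x + G y)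
    (hGmul : ∀ x f, ε * x = 0 → G (x * f) = G x * f)
    (hfaith : ∀ w : F, (∀ f, w * f * e = 0) → w = 0)
    (hlift : ∀ f, ∃ x, q * f * e = ε * x)
    (hq : q * ε = ε)
    (H : HasInjectiveResolutionWithProjectivePrefix F 3) :
    ∃ t, ∀ x, ε * x = 0 → G x = t * x := by
  obtain ⟨I, f₀, d, hf₀, h0, hd, hinj, hproj⟩ := H
  have hB : ∀ n, Module.Baer Fᵐᵒᵖ (I n) := fun n => Module.Baer.of_injective (hinj n)
  have opmul : ∀ {M : Type} [AddCommGroup M] [Module Fᵐᵒᵖ M] (φ : F →ₗ[Fᵐᵒᵖ] M) (a b : F),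
      φ (a * b) = MulOpposite.op b • φ a := by
    intro M _ _ φ a b
    rw [← map_smul]; rfl
  -- the right ideal `K = ker (ε * ·)`
  let K : Ideal Fᵐᵒᵖ :=
    { carrier := {x | ε * x.unop = 0}
      add_mem' := by
        intro a b ha hb
        simp only [Set.mem_ofPred_eq] at *
        simp [mul_add, ha, hb]
      zero_mem' := by simp
      smul_mem' := by
        intro c x hx
        simp only [Set.mem_ofPred_eq] at *
        simp [← mul_assoc, hx] }
  let φ : K →ₗ[Fᵐᵒᵖ] I 0 :=
    { toFun := fun x => f₀ (G x.1.unop)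
      map_add' := by
        intro x y
        have := hGadd x.1.unop y.1.unop x.2 y.2
        simp [this]
      map_smul' := by
        intro c x
        have := hGmul x.1.unop c.unop x.2
        simp [this, opmul] }
  obtain ⟨φ', hφ'⟩ := hB 0 K φ
  have hj0 : ∀ x, ε * x = 0 → f₀ (G x) = MulOpposite.op x • φ' 1 := by
    intro x hx
    have := hφ' (MulOpposite.op x) hx
    rw [← map_smul, smul_eq_mul, mul_one, this]
    rfl
  let L : Ideal Fᵐᵒᵖ := Ideal.span {MulOpposite.op ε}
  have hL : ∀ x : L, ∃ y : F, x.1.unop = ε * y := by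
    rintro ⟨x, hx⟩
    obtain ⟨a, ha⟩ := Ideal.mem_span_singleton'.1 hx
    exact ⟨a.unop, congrArg MulOpposite.unop ha.symm⟩
  choose r hr using hL
  have hwd : ∀ x y, ε * x = ε * y →
      d 0 (MulOpposite.op x • φ' 1) = d 0 (MulOpposite.op y • φ' 1) := by
    intro x y hxy
    have h1 : ε * (x - y) = 0 := by rw [mul_sub, hxy, sub_self]
    have h2 := hj0 _ h1
    have h3 : d 0 (f₀ (G (x - y))) = 0 := h0.apply_apply_eq_zero _
    rw [h2, MulOpposite.op_sub, sub_smul, map_sub, sub_eq_zero] at h3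
    exact h3
  let ψ : L →ₗ[Fᵐᵒᵖ] I 1 :=
    { toFun := fun x => d 0 (MulOpposite.op (r x) • φ' 1)
      map_add' := by
        intro x y
        rw [← map_add, ← add_smul, ← MulOpposite.op_add]
        apply hwd
        rw [← hr, mul_add, ← hr, ← hr]; rfl
      map_smul' := by
        intro c x
        rw [RingHom.id_apply, ← map_smul (d 0) c, ← mul_smul]
        have : c * MulOpposite.op (r x) = MulOpposite.op (r x * c.unop) := rfl
        rw [this]
        apply hwd
        rw [← hr, ← mul_assoc, ← hr]; rfl }
  obtain ⟨ψ', hψ'⟩ := hB 1 L ψ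
  have hj1 : ∀ x, MulOpposite.op (ε * x) • ψ' 1 = d 0 (MulOpposite.op x • φ' 1) := by
    intro x
    have hmem : MulOpposite.op (ε * x) ∈ L := by
      rw [MulOpposite.op_mul]
      exact Ideal.mul_mem_left _ _ (Ideal.subset_span rfl)
    have := hψ' _ hmem
    rw [← map_smul, smul_eq_mul, mul_one, this]
    apply hwd
    rw [← hr]; rfl
  -- w = 0
  have hw : d 1 (MulOpposite.op q • ψ' 1) = 0 := by
    set w := d 1 (MulOpposite.op q • ψ' 1) with hwdef
    have h1 : ∀ f : F, MulOpposite.op (f * e) • w = 0 := by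
      intro f
      obtain ⟨x, hx⟩ := hlift f
      rw [hwdef, ← map_smul, ← mul_smul, ← MulOpposite.op_mul, ← mul_assoc, hx, hj1]
      exact (hd 0).apply_apply_eq_zero _
    have := hproj 2 (by norm_num)
    obtain ⟨s, hs⟩ := (Module.projective_def (R := Fᵐᵒᵖ) (P := I 2)).1 this
    have h2 : s w = 0 := by
      ext i
      apply MulOpposite.unop_injective
      apply hfaith
      intro f
      have h3 := congrArg s (h1 f)
      rw [map_smul, map_zero] at h3
      have h4 := congrArg MulOpposite.unop (DFunLike.congr_fun h3 i)
      rw [mul_assoc]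
      simpa using h4
    rw [← hs w, h2, map_zero]
  obtain ⟨y, hy⟩ := (hd 0 _).1 hw
  have h5 : d 0 (φ' 1 - MulOpposite.op ε • y) = 0 := by
    have h6 := hj1 1
    rw [mul_one, MulOpposite.op_one, one_smul] at h6
    rw [map_sub, map_smul, hy, ← mul_smul, ← MulOpposite.op_mul, hq, h6, sub_self]
  obtain ⟨t, ht⟩ := (h0 _).1 h5
  refine ⟨t, fun x hx => hf₀ ?_⟩
  rw [hj0 x hx, opmul, ht, smul_sub, ← mul_smul, ← MulOpposite.op_mul, hx]
  simp
end Lemma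
end DomDimAux
namespace DomDimAux

/-- The data of the endomorphism ring `F` of a representation `σ` on `V`. -/
structure EndData (k P V F : Type) [Field k] [Group P] [AddCommGroup V] [Module k V] [Ring F]
    (σ : Representation k P V) where
  ρ : F →+* Module.End k V
  comm : ∀ f g v, ρ f (σ g v) = σ g (ρ f v)
  inj : Function.Injective ρ
  ex : ∀ u : V →ₗ[k] V, (∀ g v, u (σ g v) = σ g (u v)) → ∃ f, ρ f = u
  v0 : V
  δ : V →ₗ[k] k
  δ_one : δ v0 = 1
  δ_ne : ∀ g, g ≠ 1 → δ (σ g v0) = 0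
  v1 : V
  η : V →ₗ[k] k
  v1_inv : ∀ g, σ g v1 = v1
  η_inv : ∀ g v, η (σ g v) = η v
  η_v1 : η v1 = 1

variable {k P V F : Type} [Field k] [Group P] [Fintype P] [AddCommGroup V] [Module k V] [Ring F]
    {σ : Representation k P V} (D : EndData k P V F σ)

namespace EndData

/-- The transfer of the rank one map `w ↦ φ w • v`. -/
noncomputable def Tl (_ : EndData k P V F σ) (φ : V →ₗ[k] k) (v : V) : V →ₗ[k] V :=
  ∑ g : P, (φ ∘ₗ σ g⁻¹).smulRight (σ g v)

theorem Tl_apply (φ : V →ₗ[k] k) (v w : V) :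
    D.Tl φ v w = ∑ g : P, φ (σ g⁻¹ w) • σ g v := by
  simp [Tl, LinearMap.sum_apply]

theorem Tl_comm (φ : V →ₗ[k] k) (v : V) (h : P) (w : V) :
    D.Tl φ v (σ h w) = σ h (D.Tl φ v w) := by
  rw [Tl_apply, Tl_apply, map_sum]
  rw [← Equiv.sum_comp (Equiv.mulLeft h)]
  refine Finset.sum_congr rfl fun g _ => ?_
  simp only [Equiv.coe_mulLeft, mul_inv_rev, map_mul, Module.End.mul_apply, map_smul]
  rw [← Module.End.mul_apply (σ h⁻¹), ← map_mul, inv_mul_cancel, map_one, Module.End.one_apply]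

noncomputable def T (φ : V →ₗ[k] k) (v : V) : F := (D.ex (D.Tl φ v) (D.Tl_comm φ v)).choose

theorem T_apply (φ : V →ₗ[k] k) (v w : V) :
    D.ρ (D.T φ v) w = ∑ g : P, φ (σ g⁻¹ w) • σ g v := by
  rw [T, (D.ex (D.Tl φ v) (D.Tl_comm φ v)).choose_spec, Tl_apply]

theorem ext {a b : F} (h : ∀ v, D.ρ a v = D.ρ b v) : a = b :=
  D.inj (LinearMap.ext h)

theorem mul_T (u : F) (φ : V →ₗ[k] k) (v : V) : u * D.T φ v = D.T φ (D.ρ u v) := by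
  apply D.ext
  intro w
  simp only [map_mul, Module.End.mul_apply, T_apply, map_sum, map_smul, comm]

theorem T_mul (u : F) (φ : V →ₗ[k] k) (v : V) : D.T φ v * u = D.T (φ ∘ₗ D.ρ u) v := by
  apply D.ext
  intro w
  simp only [map_mul, Module.End.mul_apply, T_apply, LinearMap.comp_apply, comm]

theorem T_zero (φ : V →ₗ[k] k) : D.T φ 0 = 0 := by
  apply D.ext
  intro w
  simp [T_apply]

theorem sum_δ {M : Type} [AddCommGroup M] [Module k M] (c : P → M) (h : P) :
    ∑ g : P, D.δ (σ g⁻¹ (σ h D.v0)) • c g = c h := by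
  rw [Finset.sum_eq_single h]
  · rw [← Module.End.mul_apply, ← map_mul, inv_mul_cancel, map_one, Module.End.one_apply, D.δ_one,
      one_smul]
  · intro g _ hg
    rw [← Module.End.mul_apply, ← map_mul, D.δ_ne, zero_smul]
    intro h1
    exact hg (inv_mul_eq_one.1 h1)
  · simp

theorem T_δ_v0 (v : V) : D.ρ (D.T D.δ v) D.v0 = v := by
  rw [T_apply]
  have := D.sum_δ (fun g => σ g v) 1
  simpa using this

theorem δ_T (φ : V →ₗ[k] k) (w : V) : D.δ (D.ρ (D.T φ D.v0) w) = φ w := by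
  rw [T_apply, map_sum, Finset.sum_eq_single 1]
  · simp [D.δ_one]
  · intro g _ hg
    rw [map_smul, D.δ_ne g hg, smul_zero]
  · simp

/-- `Hom_k(V, W)` as a right `F`-module. -/
def J (_ : EndData k P V F σ) (W : Type) [AddCommGroup W] [Module k W] : Type := V →ₗ[k] W

variable (W : Type) [AddCommGroup W] [Module k W]

noncomputable instance : AddCommGroup (D.J W) := inferInstanceAs (AddCommGroup (V →ₗ[k] W))

def toJ (φ : V →ₗ[k] W) : D.J W := φ
def ofJ {D : EndData k P V F σ} {W : Type} [AddCommGroup W] [Module k W] (φ : D.J W) :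
    V →ₗ[k] W := φ

noncomputable instance : Module Fᵐᵒᵖ (D.J W) where
  smul x φ := D.toJ W (ofJ φ ∘ₗ D.ρ x.unop)
  one_smul φ := by
    change (ofJ φ ∘ₗ D.ρ 1) = φ
    rw [map_one]; rfl
  mul_smul x y φ := by
    change (ofJ φ ∘ₗ D.ρ (y.unop * x.unop)) = (ofJ φ ∘ₗ D.ρ y.unop) ∘ₗ D.ρ x.unop
    rw [map_mul]; rfl
  smul_zero x := by
    change ((0 : V →ₗ[k] W) ∘ₗ D.ρ x.unop) = 0
    simp
  smul_add x φ ψ := by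
    change ((ofJ φ + ofJ ψ) ∘ₗ D.ρ x.unop) = ofJ φ ∘ₗ D.ρ x.unop + ofJ ψ ∘ₗ D.ρ x.unop
    simp [LinearMap.add_comp]
  add_smul x y φ := by
    change (ofJ φ ∘ₗ D.ρ (x.unop + y.unop)) = ofJ φ ∘ₗ D.ρ x.unop + ofJ φ ∘ₗ D.ρ y.unop
    rw [map_add, LinearMap.comp_add]
  zero_smul φ := by
    change (ofJ φ ∘ₗ D.ρ 0) = 0
    rw [map_zero, LinearMap.comp_zero]

variable {W}
theorem ofJ_smul (x : Fᵐᵒᵖ) (φ : D.J W) (v : V) : ofJ (x • φ) v = ofJ φ (D.ρ x.unop v) := rfl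
theorem ofJ_add (φ ψ : D.J W) (v : V) : ofJ (φ + ψ) v = ofJ φ v + ofJ ψ v := rfl
theorem ofJ_zero (v : V) : ofJ (0 : D.J W) v = 0 := rfl
theorem J_ext {φ ψ : D.J W} (h : ∀ v, ofJ φ v = ofJ ψ v) : φ = ψ := LinearMap.ext h
theorem ofJ_toJ (φ : V →ₗ[k] W) : ofJ (D.toJ W φ) = φ := rfl
variable (W)

theorem J_injective : Module.Injective Fᵐᵒᵖ (D.J W) := by
  apply Module.Baer.injective
  intro I φ
  let e : F := D.T D.δ D.v0
  have hmul : ∀ (l : I) (f : F) (v : V), ofJ (φ l) (D.ρ f v) = ofJ (φ (MulOpposite.op f • l)) v := by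
    intro l f v
    rw [map_smul]; rfl
  -- scalars
  let sc : k → F := fun c => D.T D.δ (c • D.v0)
  let S : Submodule k V :=
    { carrier := {v | ∃ l : I, D.ρ l.1.unop D.v0 = v}
      add_mem' := by
        rintro _ _ ⟨l, rfl⟩ ⟨m, rfl⟩
        exact ⟨l + m, by simp⟩
      zero_mem' := ⟨0, by simp⟩
      smul_mem' := by
        rintro c _ ⟨l, rfl⟩
        refine ⟨MulOpposite.op (sc c) • l, ?_⟩
        simp [sc, T_δ_v0] }
  have hS : ∀ v : S, ∃ l : I, D.ρ l.1.unop D.v0 = v := fun v => v.2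
  choose r hr using hS
  have hwd0 : ∀ l : I, D.ρ l.1.unop D.v0 = 0 → ofJ (φ l) D.v0 = 0 := by
    intro l hl
    have h1 : MulOpposite.op e • l = 0 := by
      apply Subtype.ext
      apply MulOpposite.unop_injective
      change l.1.unop * e = 0
      rw [mul_T, hl, T_zero]
    rw [← D.T_δ_v0 D.v0, hmul, h1, map_zero, ofJ_zero]
  have hwd : ∀ l m : I, D.ρ l.1.unop D.v0 = D.ρ m.1.unop D.v0 →
      ofJ (φ l) D.v0 = ofJ (φ m) D.v0 := by
    intro l m hlm
    have h1 := hwd0 (l - m) (by simp [hlm])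
    have h2 : φ l = φ (l - m) + φ m := by rw [← map_add, sub_add_cancel]
    rw [h2, ofJ_add, h1, zero_add]
  let ψ : S →ₗ[k] W :=
    { toFun := fun v => ofJ (φ (r v)) D.v0
      map_add' := by
        intro v w
        rw [← ofJ_add, ← map_add]
        apply hwd
        rw [hr]
        simp [hr]
      map_smul' := by
        intro c v
        have : c • ofJ (φ (r v)) D.v0 = ofJ (φ (MulOpposite.op (sc c) • r v)) D.v0 := by
          rw [← hmul, T_δ_v0, map_smul]
        rw [RingHom.id_apply, this]
        apply hwd
        rw [hr]
        simp [sc, T_δ_v0, hr] }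
  obtain ⟨ψ', hψ'⟩ := LinearMap.exists_extend ψ
  refine ⟨LinearMap.toSpanSingleton Fᵐᵒᵖ (D.J W) (D.toJ W ψ'), ?_⟩
  intro x hx
  apply D.J_ext
  intro v
  rw [LinearMap.toSpanSingleton_apply, ofJ_smul, ofJ_toJ]
  have h1 : ofJ (φ ⟨x, hx⟩) v = ofJ (φ (MulOpposite.op (D.T D.δ v) • ⟨x, hx⟩)) D.v0 := by
    rw [← hmul, T_δ_v0]
  have h3 : D.ρ (MulOpposite.op (D.T D.δ v) • (⟨x, hx⟩ : I)).1.unop D.v0 = D.ρ x.unop v := by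
    simp [T_δ_v0]
  have h2 : D.ρ x.unop v ∈ S := ⟨_, h3⟩
  have h4 : ψ' (D.ρ x.unop v) = ψ ⟨_, h2⟩ := by
    rw [← hψ']; rfl
  rw [h4, h1]
  apply hwd
  rw [hr, h3]

theorem J_projective [FiniteDimensional k W] : Module.Projective Fᵐᵒᵖ (D.J W) := by
  let b := Module.finBasis k W
  let s : D.J W →ₗ[Fᵐᵒᵖ] (Fin (Module.finrank k W) → Fᵐᵒᵖ) :=
    { toFun := fun φ i => MulOpposite.op (D.T (b.coord i ∘ₗ ofJ φ) D.v0)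
      map_add' := by
        intro φ ψ
        ext i
        apply MulOpposite.unop_injective
        apply D.ext
        intro v
        simp [T_apply, ofJ_add, add_smul, Finset.sum_add_distrib]
      map_smul' := by
        intro x φ
        ext i
        apply MulOpposite.unop_injective
        change D.T _ D.v0 = D.T (b.coord i ∘ₗ ofJ φ) D.v0 * x.unop
        rw [T_mul]
        rfl }
  let r : (Fin (Module.finrank k W) → Fᵐᵒᵖ) →ₗ[Fᵐᵒᵖ] D.J W :=
    { toFun := fun f => D.toJ W (∑ i, (D.δ ∘ₗ D.ρ (f i).unop).smulRight (b i))
      map_add' := by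
        intro f g
        apply D.J_ext
        intro v
        simp [ofJ_add, ofJ_toJ, add_smul, Finset.sum_add_distrib]
      map_smul' := by
        intro x f
        apply D.J_ext
        intro v
        simp [ofJ_smul, ofJ_toJ] }
  refine Module.Projective.of_split s r ?_
  ext φ
  apply D.J_ext
  intro v
  simp only [s, r, LinearMap.comp_apply, LinearMap.coe_mk, AddHom.coe_mk, ofJ_toJ,
    LinearMap.sum_apply, LinearMap.smulRight_apply, MulOpposite.unop_op, δ_T, LinearMap.id_apply]
  simp

theorem lower (D : EndData k P V F σ) [FiniteDimensional k V] :
    ∃ (J₀ J₁ : ModuleCat.{0} Fᵐᵒᵖ) (f₀ : F →ₗ[Fᵐᵒᵖ] J₀) (f₁ : (J₀ : Type) →ₗ[Fᵐᵒᵖ] J₁),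
        Function.Injective f₀ ∧ Function.Exact f₀ f₁ ∧
        Module.Projective Fᵐᵒᵖ J₀ ∧ Module.Injective Fᵐᵒᵖ J₀ ∧
        Module.Projective Fᵐᵒᵖ J₁ ∧ Module.Injective Fᵐᵒᵖ J₁ := by
  let f₀ : F →ₗ[Fᵐᵒᵖ] D.J V :=
    { toFun := fun f => D.toJ V (D.ρ f)
      map_add' := by intro a b; simp only [map_add]; rfl
      map_smul' := by
        intro x f
        apply D.J_ext
        intro v
        simp [ofJ_toJ, ofJ_smul] }
  let f₁ : D.J V →ₗ[Fᵐᵒᵖ] D.J (P → V) :=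
    { toFun := fun φ => D.toJ (P → V) (LinearMap.pi fun g => ofJ φ ∘ₗ σ g - σ g ∘ₗ ofJ φ)
      map_add' := by
        intro a b
        apply D.J_ext
        intro v
        ext g
        simp [ofJ_toJ, ofJ_add]
        abel
      map_smul' := by
        intro x f
        apply D.J_ext
        intro v
        ext g
        simp [ofJ_toJ, ofJ_smul, D.comm] }
  refine ⟨ModuleCat.of _ (D.J V), ModuleCat.of _ (D.J (P → V)), f₀, f₁, ?_, ?_,
    D.J_projective V, D.J_injective V, D.J_projective _, D.J_injective _⟩
  · exact D.inj
  · intro φ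
    constructor
    · intro h
      obtain ⟨f, hf⟩ := D.ex (ofJ φ) (by
        intro g v
        have := congrFun (LinearMap.congr_fun (congrArg (ofJ (D := D)) h) v) g
        exact sub_eq_zero.1 this)
      exact ⟨f, hf⟩
    · rintro ⟨f, rfl⟩
      apply D.J_ext
      intro v
      ext g
      exact sub_eq_zero.2 (D.comm f g v)

theorem upper (D : EndData k P V F σ) (χ : P → k) (hχ : ∀ g h, χ (g * h) = χ g + χ h) (h : P) (hh : χ h ≠ 0) :
    ¬ HasInjectiveResolutionWithProjectivePrefix F 3 := by
  classical
  intro H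
  have hv1 : D.v1 ≠ 0 := by
    intro h0
    have := D.η_v1
    rw [h0, map_zero] at this
    exact zero_ne_one this
  obtain ⟨q, hq⟩ := D.ex (D.η.smulRight D.v1) (by intro g v; simp [D.η_inv, D.v1_inv])
  have hqv : ∀ v, D.ρ q v = D.η v • D.v1 := by intro v; rw [hq]; rfl
  set ε : F := D.T D.δ D.v1 with hε
  have hεa : ∀ w, D.ρ ε w = (∑ g : P, D.δ (σ g⁻¹ w)) • D.v1 := by
    intro w
    rw [hε, T_apply, Finset.sum_smul]
    simp only [D.v1_inv]
  have hε0 : ∀ x, ε * x = 0 → ∀ w, ∑ g : P, D.δ (σ g⁻¹ (D.ρ x w)) = 0 := by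
    intro x hx w
    have h1 := hεa (D.ρ x w)
    rw [← Module.End.mul_apply, ← map_mul, hx, map_zero, LinearMap.zero_apply] at h1
    exact (smul_eq_zero.1 h1.symm).resolve_right hv1
  let Gl : F → (V →ₗ[k] V) := fun x => ∑ g : P, (χ g • (D.δ ∘ₗ σ g⁻¹ ∘ₗ D.ρ x)).smulRight D.v1
  have hGl : ∀ x w, Gl x w = (∑ g : P, χ g • D.δ (σ g⁻¹ (D.ρ x w))) • D.v1 := by
    intro x w
    simp [Gl, LinearMap.sum_apply, Finset.sum_smul]
  have hGc : ∀ x, ε * x = 0 → ∀ g v, Gl x (σ g v) = σ g (Gl x v) := by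
    intro x hx a w
    rw [hGl, hGl, map_smul, D.v1_inv]
    congr 1
    rw [← Equiv.sum_comp (Equiv.mulLeft a)]
    have h1 : ∀ g, σ (a * g)⁻¹ (D.ρ x (σ a w)) = σ g⁻¹ (D.ρ x w) := by
      intro g
      rw [D.comm, ← Module.End.mul_apply, ← map_mul]
      congr 2
      group
    simp only [Equiv.coe_mulLeft, h1, hχ, add_smul, Finset.sum_add_distrib]
    rw [← Finset.smul_sum, hε0 x hx, smul_zero, zero_add]
  let G : F → F := fun x => if hx : ε * x = 0 then (D.ex (Gl x) (hGc x hx)).choose else 0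
  have hG : ∀ x, ε * x = 0 → ∀ w, D.ρ (G x) w = Gl x w := by
    intro x hx w
    simp only [G, dif_pos hx]
    rw [(D.ex (Gl x) (hGc x hx)).choose_spec]
  obtain ⟨t, ht⟩ := core (D.T D.δ D.v0) q ε G
    (by
      intro x y hx hy
      apply D.ext
      intro w
      rw [hG _ (by rw [mul_add, hx, hy, add_zero]), map_add, LinearMap.add_apply, hG _ hx, hG _ hy]
      simp [hGl, add_smul, mul_add, Finset.sum_add_distrib])
    (by
      intro x f hx
      apply D.ext
      intro w
      rw [hG _ (by rw [← mul_assoc, hx, zero_mul]), map_mul, Module.End.mul_apply, hG _ hx]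
      simp [hGl])
    (by
      intro w hw
      apply D.ext
      intro v
      have h1 := hw (D.T D.δ v)
      rw [mul_T, map_mul, Module.End.mul_apply, T_δ_v0] at h1
      have h2 := congrArg (fun z => D.ρ z D.v0) h1
      simpa [T_δ_v0] using h2)
    (by
      intro f
      refine ⟨D.T D.δ (D.η (D.ρ f D.v0) • D.v0), ?_⟩
      rw [mul_T, mul_T, map_mul, Module.End.mul_apply, hqv, map_smul, hε, T_δ_v0])
    (by rw [hε, mul_T, hqv, D.η_v1, one_smul])
    H
  have hx : ε * D.T D.δ (σ h D.v0 - D.v0) = 0 := by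
    rw [mul_T, map_sub, D.comm, hε, T_δ_v0, D.v1_inv, sub_self, T_zero]
  have h1 := congrArg (fun z => D.η (D.ρ z D.v0)) (ht _ hx)
  simp only [hG _ hx, hGl, T_δ_v0, map_mul, Module.End.mul_apply, map_sub, D.comm, D.η_inv,
    sub_self, map_smul, D.η_v1, smul_eq_mul, mul_sub, mul_one, Finset.sum_sub_distrib] at h1
  have h2 := D.sum_δ χ h
  have h3 := D.sum_δ χ 1
  have h4 : χ 1 = 0 := by simpa using hχ 1 1
  simp only [smul_eq_mul, mul_comm, map_one, Module.End.one_apply] at h1 h2 h3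
  rw [h2, h3, h4, sub_zero] at h1
  exact hh h1

end EndData
end DomDimAux

namespace DomDimAux

section Instance
variable (k : Type) [Field k] (P : Type) [Group P]

/-- The underlying vector space of `V`. -/
abbrev VV : Type := Π Q : Subgroup P, (Representation.ofMulAction k P (P ⧸ Q)).asModule

/-- The representation of `P` on `V`. -/
noncomputable def sig : Representation k P (VV k P) where
  toFun g := LinearMap.pi fun Q =>
    (Representation.ofMulAction k P (P ⧸ Q)).asModuleEquiv.symm.toLinearMap ∘ₗ
      (Representation.ofMulAction k P (P ⧸ Q) g) ∘ₗ
      (Representation.ofMulAction k P (P ⧸ Q)).asModuleEquiv.toLinearMap ∘ₗ LinearMap.proj Q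
  map_one' := by
    ext v Q
    simp
  map_mul' g h := by
    refine LinearMap.ext fun v => funext fun Q => ?_
    change (Representation.ofMulAction k P (P ⧸ Q) (g * h)) _ =
      Representation.ofMulAction k P (P ⧸ Q) g (Representation.ofMulAction k P (P ⧸ Q) h _)
    rw [map_mul]
    rfl

theorem sig_eq (g : P) (v : VV k P) : sig k P g v = MonoidAlgebra.of k P g • v := by
  funext Q
  exact Representation.asModuleEquiv_symm_map_rho
    (Representation.ofMulAction k P (P ⧸ Q)) g (v Q)

theorem smul_eq (c : k) (v : VV k P) :
    c • v = algebraMap k (MonoidAlgebra k P) c • v := by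
  funext Q
  exact Representation.asModuleEquiv_symm_map_smul
    (Representation.ofMulAction k P (P ⧸ Q)) c (v Q)

/-- coordinate functional -/
noncomputable def coordFun (Q : Subgroup P) : VV k P →ₗ[k] k :=
  Finsupp.lapply (QuotientGroup.mk 1 : P ⧸ Q) ∘ₗ
    (MonoidAlgebra.coeffLinearEquiv k).toLinearMap ∘ₗ
    (Representation.ofMulAction k P (P ⧸ Q)).asModuleEquiv.toLinearMap ∘ₗ LinearMap.proj Q

open Classical in
/-- basis vector -/
noncomputable def bv (Q : Subgroup P) : VV k P :=
  Pi.single Q ((Representation.ofMulAction k P (P ⧸ Q)).asModuleEquiv.symm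
    (MonoidAlgebra.single (QuotientGroup.mk 1 : P ⧸ Q) 1))

theorem coord_sig (Q : Subgroup P) (g : P) (v : VV k P) : coordFun k P Q (sig k P g v) =
    ((Representation.ofMulAction k P (P ⧸ Q)).asModuleEquiv (v Q)).coeff
      (QuotientGroup.mk g⁻¹ : P ⧸ Q) := by
  refine (Representation.coeff_ofMulAction g _ _).trans ?_
  congr 1
  exact congrArg QuotientGroup.mk (mul_one g⁻¹)

theorem endData : Nonempty (DomDimAux.EndData k P (VV k P)
    (EndOfSumOfInducedTrivialModules k P) (sig k P)) := by
  classical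
  have hsub : Subsingleton (P ⧸ (⊤ : Subgroup P)) := QuotientGroup.subsingleton_quotient_top
  refine ⟨{
    ρ :=
      { toFun := fun f =>
          { toFun := fun v => f.hom v
            map_add' := fun a b => map_add f.hom a b
            map_smul' := fun c v => by
              rw [smul_eq, map_smul, RingHom.id_apply, smul_eq] }
        map_one' := rfl
        map_mul' := fun _ _ => rfl
        map_zero' := rfl
        map_add' := fun _ _ => rfl }
    comm := ?_
    inj := ?_
    ex := ?_
    v0 := bv k P ⊥
    δ := coordFun k P ⊥
    δ_one := ?_
    δ_ne := ?_
    v1 := bv k P ⊤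
    η := coordFun k P ⊤
    v1_inv := ?_
    η_inv := ?_
    η_v1 := ?_ }⟩
  · intro f g v
    rw [sig_eq, sig_eq]
    exact map_smul f.hom _ _
  · intro a b hab
    apply ModuleCat.hom_ext
    ext1 v
    exact LinearMap.congr_fun hab v
  · intro u hu
    refine ⟨ModuleCat.ofHom
      { toFun := fun v => u v
        map_add' := map_add u
        map_smul' := ?_ }, rfl⟩
    intro r v
    induction r using MonoidAlgebra.induction_on with
    | of g =>
      have := hu g v
      rw [sig_eq, sig_eq] at this
      exact this
    | add a b ha hb =>
      simp only [RingHom.id_apply] at *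
      rw [add_smul, map_add, ha, hb, add_smul]
    | smul c a ha =>
      simp only [RingHom.id_apply] at *
      rw [Algebra.smul_def, mul_smul, mul_smul, ← smul_eq, ← smul_eq, map_smul, ha]
  · simp [coordFun, bv]
  · intro g hg
    rw [coord_sig]
    simp [bv]
    rw [Finsupp.single_apply, if_neg]
    intro h
    have h1 := QuotientGroup.eq.1 h
    simp at h1
    exact hg h1
  · intro g
    funext Q
    by_cases hQ : Q = ⊤
    · subst hQ
      simp [sig, bv]
      congr 2
      exact Subsingleton.elim _ _
    · simp [sig, bv, hQ]
  · intro g v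
    rw [coord_sig]
    simp [coordFun]
    congr 1
    exact Subsingleton.elim _ _
  · simp [coordFun, bv]

end Instance
end DomDimAux

/-- Let `k` be a field of prime characteristic `p`, let `P` be a nontrivial finite `p`-group,
let `V = ⨁_{Q ≤ P} kP ⊗_{kQ} k` and `F = End_{kP}(V)`.  Then the dominant dimension of `F` is
exactly `2`: there is an exact sequence `0 → F → J⁰ → J¹` of right `F`-modules with `J⁰, J¹`
both projective and injective, but no injective resolution `0 → F → J⁰ → J¹ → J² → ⋯` of `F`
as a right `F`-module has `J⁰, J¹, J²` all projective. -/
theorem dominantDimension_eq_two_of_endOfSumOfInduced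
    (k : Type) [Field k] (p : ℕ) (hp : p.Prime) [CharP k p]
    (P : Type) [Group P] [Finite P] [Nontrivial P] (hP : IsPGroup p P) :
    (∃ (J₀ J₁ : ModuleCat.{0} (EndOfSumOfInducedTrivialModules k P)ᵐᵒᵖ)
       (f₀ : EndOfSumOfInducedTrivialModules k P →ₗ[(EndOfSumOfInducedTrivialModules k P)ᵐᵒᵖ] J₀)
       (f₁ : (J₀ : Type) →ₗ[(EndOfSumOfInducedTrivialModules k P)ᵐᵒᵖ] J₁),
        Function.Injective f₀ ∧ Function.Exact f₀ f₁ ∧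
        Module.Projective (EndOfSumOfInducedTrivialModules k P)ᵐᵒᵖ J₀ ∧
        Module.Injective (EndOfSumOfInducedTrivialModules k P)ᵐᵒᵖ J₀ ∧
        Module.Projective (EndOfSumOfInducedTrivialModules k P)ᵐᵒᵖ J₁ ∧
        Module.Injective (EndOfSumOfInducedTrivialModules k P)ᵐᵒᵖ J₁) ∧
      ¬ HasInjectiveResolutionWithProjectivePrefix (EndOfSumOfInducedTrivialModules k P) 3 := by
  obtain ⟨D⟩ := DomDimAux.endData k P
  obtain ⟨χ, hχ, h, hh⟩ := DomDimAux.exists_chi k p hp P hP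
  have : Fintype P := Fintype.ofFinite P
  have : ∀ Q : Subgroup P, Module.Finite k (MonoidAlgebra k (P ⧸ Q)) := fun Q =>
    Module.Finite.equiv (MonoidAlgebra.coeffLinearEquiv k).symm
  exact ⟨D.lower, D.upper χ hχ h hh⟩
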